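/- Assume f defines a quasihomogeneous isolated singularity. Then the complex (PV, ∂̄_f) is exact in positive exterior degrees: for every p ≥ 1, ker(∂̄_f : PV^p → PV^{p−1}) = range(∂̄_f : PV^{p+1} → PV^p); moreover, identifying PV^0 with R, range(∂̄_f : PV^1 → PV^0) = J(f), so that the degree-zero cohomology R/range(∂̄_f) is Jac(f). -/

import Mathlib

open MvPolynomial TensorProduct

noncomputable section

/-- The Jacobian ideal of `f`. -/
def jacobianIdeal {N : ℕ} (f : MvPolynomial (Fin N) ℂ) :
    Ideal (MvPolynomial (Fin N) ℂ) :=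
  Ideal.span (Set.range fun k : Fin N => pderiv k f)

/-- The exterior algebra `⋀(ℂ^N)` on the generators `θ₁,…,θ_N`. -/
abbrev ExtN (N : ℕ) := ExteriorAlgebra ℂ (Fin N → ℂ)

/-- Polynomial polyvector fields `PV = R ⊗ ⋀(ℂ^N)`. -/
abbrev PV (N : ℕ) := MvPolynomial (Fin N) ℂ ⊗[ℂ] ExtN N

/-- Contraction (interior product) with the `k`-th dual covector. -/
def contr {N : ℕ} (k : Fin N) : ExtN N →ₗ[ℂ] ExtN N :=
  CliffordAlgebra.contractLeft (LinearMap.proj k)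

/-- The Koszul differential `∂̄_g(α ⊗ ω) = Σ_k (∂g/∂x_k · α) ⊗ ι_k(ω)`. -/
def dbar {N : ℕ} (g : MvPolynomial (Fin N) ℂ) : PV N →ₗ[ℂ] PV N :=
  ∑ k : Fin N, TensorProduct.map (LinearMap.mulLeft ℂ (pderiv k g)) (contr k)

/-- The `p`-th exterior power, as a submodule of the exterior algebra. -/
def grE (N p : ℕ) : Submodule ℂ (ExtN N) :=
  (LinearMap.range (ExteriorAlgebra.ι ℂ : (Fin N → ℂ) →ₗ[ℂ] ExtN N)) ^ p

/-- The graded piece `PV^p = R ⊗ ⋀^p(ℂ^N)` of `PV`. -/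
def PVgr (N p : ℕ) : Submodule ℂ (PV N) :=
  LinearMap.range (TensorProduct.map (LinearMap.id : MvPolynomial (Fin N) ℂ →ₗ[ℂ] _)
    (grE N p).subtype)


namespace KZ

variable {N : ℕ}

/-- Apply a functional on the exterior factor. -/
def cf (φ : ExtN N →ₗ[ℂ] ℂ) : PV N →ₗ[ℂ] MvPolynomial (Fin N) ℂ :=
  (TensorProduct.rid ℂ (MvPolynomial (Fin N) ℂ)).toLinearMap ∘ₗ
    TensorProduct.map LinearMap.id φ

lemma cf_tmul (φ : ExtN N →ₗ[ℂ] ℂ) (r : MvPolynomial (Fin N) ℂ) (e : ExtN N) :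
    cf φ (r ⊗ₜ e) = φ e • r := by
  simp [cf]

lemma cf_smul (φ : ExtN N →ₗ[ℂ] ℂ) (a : MvPolynomial (Fin N) ℂ) (y : PV N) :
    cf φ (a • y) = a * cf φ y := by
  induction y using TensorProduct.induction_on with
  | zero => simp
  | tmul r e => rw [TensorProduct.smul_tmul', cf_tmul, cf_tmul, smul_eq_mul, mul_smul_comm]
  | add x y hx hy => rw [smul_add, map_add, map_add, hx, hy, mul_add]

lemma cf_map (φ : ExtN N →ₗ[ℂ] ℂ) (a : MvPolynomial (Fin N) ℂ) (T : ExtN N →ₗ[ℂ] ExtN N)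
    (y : PV N) :
    cf φ (TensorProduct.map (LinearMap.mulLeft ℂ a) T y) = a * cf (φ ∘ₗ T) y := by
  induction y using TensorProduct.induction_on with
  | zero => simp
  | tmul r e => simp [cf_tmul]
  | add x y hx hy => rw [map_add, map_add, map_add, hx, hy, mul_add]

/-- `I · PV`. -/
def IK (I : Ideal (MvPolynomial (Fin N) ℂ)) : Submodule ℂ (PV N) where
  carrier := {y | ∀ φ, cf φ y ∈ I}
  add_mem' := fun {x y} hx hy φ => by rw [map_add]; exact I.add_mem (hx φ) (hy φ)
  zero_mem' := fun φ => by rw [map_zero]; exact I.zero_mem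
  smul_mem' := fun c x hx φ => by
    rw [map_smul, MvPolynomial.smul_eq_C_mul]; exact I.mul_mem_left _ (hx φ)

lemma mem_IK {I : Ideal (MvPolynomial (Fin N) ℂ)} {y : PV N} :
    y ∈ IK I ↔ ∀ φ, cf φ y ∈ I := Iff.rfl

lemma map_mem_IK {I : Ideal (MvPolynomial (Fin N) ℂ)} {y : PV N} (hy : y ∈ IK I)
    (a : MvPolynomial (Fin N) ℂ) (T : ExtN N →ₗ[ℂ] ExtN N) :
    TensorProduct.map (LinearMap.mulLeft ℂ a) T y ∈ IK I := fun φ => by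
  rw [cf_map]; exact I.mul_mem_left _ (hy _)

lemma decomp (y : PV N) : ∃ (s : Finset (Module.Basis.ofVectorSpaceIndex ℂ (ExtN N))),
    y = ∑ j ∈ s, cf ((Module.Basis.ofVectorSpace ℂ (ExtN N)).coord j) y ⊗ₜ
      (Module.Basis.ofVectorSpace ℂ (ExtN N) j) := by
  classical
  set B := Module.Basis.ofVectorSpace ℂ (ExtN N)
  suffices h : ∃ s : Finset (Module.Basis.ofVectorSpaceIndex ℂ (ExtN N)), ∀ t, s ⊆ t →
      y = ∑ j ∈ t, cf (B.coord j) y ⊗ₜ (B j) by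
    obtain ⟨s, hs⟩ := h
    exact ⟨s, hs s subset_rfl⟩
  induction y using TensorProduct.induction_on with
  | zero => exact ⟨∅, fun t _ => by simp⟩
  | tmul r e =>
    refine ⟨(B.repr e).support, fun t ht => ?_⟩
    have he : e = ∑ j ∈ t, B.repr e j • B j := by
      conv_lhs => rw [← B.linearCombination_repr e, Finsupp.linearCombination_apply]
      exact Finsupp.sum_of_support_subset _ ht _ (by simp)
    conv_lhs => rw [he, TensorProduct.tmul_sum]
    refine Finset.sum_congr rfl fun j _ => ?_
    rw [cf_tmul, TensorProduct.tmul_smul, Module.Basis.coord_apply, TensorProduct.smul_tmul']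
  | add x y hx hy =>
    obtain ⟨s, hs⟩ := hx
    obtain ⟨s', hs'⟩ := hy
    refine ⟨s ∪ s', fun t ht => ?_⟩
    simp only [map_add, TensorProduct.add_tmul, Finset.sum_add_distrib]
    rw [← hs t (Finset.union_subset_left ht), ← hs' t (Finset.union_subset_right ht)]

lemma IK_bot {y : PV N} (hy : y ∈ IK (⊥ : Ideal (MvPolynomial (Fin N) ℂ))) : y = 0 := by
  obtain ⟨s, hs⟩ := decomp y
  rw [hs]
  refine Finset.sum_eq_zero fun j _ => ?_
  rw [(Submodule.mem_bot _).1 (hy _), TensorProduct.zero_tmul]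

lemma IK_sup {I : Ideal (MvPolynomial (Fin N) ℂ)} {a : MvPolynomial (Fin N) ℂ} {y : PV N}
    (hy : y ∈ IK (Ideal.span {a} ⊔ I)) : ∃ c : PV N, ∃ i ∈ IK I, y = a • c + i := by
  obtain ⟨s, hs⟩ := decomp y
  have h : ∀ φ, ∃ u v, v ∈ I ∧ cf φ y = a * u + v := fun φ => by
    obtain ⟨u, hu, v, hv, huv⟩ := Submodule.mem_sup.1 (hy φ)
    obtain ⟨u', rfl⟩ := Ideal.mem_span_singleton'.1 hu
    exact ⟨u', v, hv, by rw [← huv, mul_comm]⟩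
  choose u v hv huv using h
  set B := Module.Basis.ofVectorSpace ℂ (ExtN N)
  refine ⟨∑ j ∈ s, u (B.coord j) ⊗ₜ B j, ∑ j ∈ s, v (B.coord j) ⊗ₜ B j, ?_, ?_⟩
  · refine Submodule.sum_mem _ fun j _ φ => ?_
    rw [cf_tmul, MvPolynomial.smul_eq_C_mul]
    exact I.mul_mem_left _ (hv _)
  · conv_lhs => rw [hs]
    rw [Finset.smul_sum, ← Finset.sum_add_distrib]
    refine Finset.sum_congr rfl fun j _ => ?_
    rw [huv, TensorProduct.add_tmul, TensorProduct.smul_tmul', smul_eq_mul]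

/-- Homotopy operator. -/
def hh (b : Fin N → MvPolynomial (Fin N) ℂ) : PV N →ₗ[ℂ] PV N :=
  ∑ k : Fin N, TensorProduct.map (LinearMap.mulLeft ℂ (b k))
    (LinearMap.mulLeft ℂ (ExteriorAlgebra.ι ℂ (Pi.single k (1 : ℂ) : Fin N → ℂ)))

lemma dbar_IK {I : Ideal (MvPolynomial (Fin N) ℂ)} {y : PV N} (hy : y ∈ IK I)
    (f : MvPolynomial (Fin N) ℂ) : dbar f y ∈ IK I := by
  rw [dbar, LinearMap.sum_apply]
  exact Submodule.sum_mem _ fun k _ => map_mem_IK hy _ _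

lemma hh_IK {I : Ideal (MvPolynomial (Fin N) ℂ)} {y : PV N} (hy : y ∈ IK I)
    (b : Fin N → MvPolynomial (Fin N) ℂ) : hh b y ∈ IK I := by
  rw [hh, LinearMap.sum_apply]
  exact Submodule.sum_mem _ fun k _ => map_mem_IK hy _ _

lemma dbar_tmul (f r : MvPolynomial (Fin N) ℂ) (e : ExtN N) :
    dbar f (r ⊗ₜ e) = ∑ k, (pderiv k f * r) ⊗ₜ contr k e := by
  simp [dbar, LinearMap.sum_apply]

lemma hh_tmul (b : Fin N → MvPolynomial (Fin N) ℂ) (r : MvPolynomial (Fin N) ℂ) (e : ExtN N) :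
    hh b (r ⊗ₜ e) = ∑ k, (b k * r) ⊗ₜ
      (ExteriorAlgebra.ι ℂ (Pi.single k (1 : ℂ) : Fin N → ℂ) * e) := by
  simp [hh, LinearMap.sum_apply]

lemma dbar_smul (f a : MvPolynomial (Fin N) ℂ) (y : PV N) : dbar f (a • y) = a • dbar f y := by
  induction y using TensorProduct.induction_on with
  | zero => simp
  | tmul r e =>
    rw [TensorProduct.smul_tmul', dbar_tmul, dbar_tmul, Finset.smul_sum]
    refine Finset.sum_congr rfl fun k _ => ?_
    rw [TensorProduct.smul_tmul', smul_eq_mul, smul_eq_mul, mul_left_comm]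
  | add x y hx hy => rw [smul_add, map_add, map_add, hx, hy, smul_add]

lemma contr_comm (k l : Fin N) (e : ExtN N) : contr k (contr l e) = - contr l (contr k e) :=
  CliffordAlgebra.contractLeft_comm _ _ _

lemma contr_ι_mul (k : Fin N) (v : Fin N → ℂ) (e : ExtN N) :
    contr k (ExteriorAlgebra.ι ℂ v * e) = v k • e - ExteriorAlgebra.ι ℂ v * contr k e :=
  CliffordAlgebra.contractLeft_ι_mul _ _ _

lemma contr_one (k : Fin N) : contr k (1 : ExtN N) = 0 :=
  CliffordAlgebra.contractLeft_one _ _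

lemma dbar_dbar (f : MvPolynomial (Fin N) ℂ) (y : PV N) : dbar f (dbar f y) = 0 := by
  induction y using TensorProduct.induction_on with
  | zero => simp
  | tmul r e =>
    have h : dbar f (dbar f (r ⊗ₜ[ℂ] e)) = - dbar f (dbar f (r ⊗ₜ[ℂ] e)) := by
      conv_lhs => rw [dbar_tmul, map_sum]; simp only [dbar_tmul]; rw [Finset.sum_comm]
      conv_rhs => rw [dbar_tmul, map_sum]; simp only [dbar_tmul]
      rw [← Finset.sum_neg_distrib]
      refine Finset.sum_congr rfl fun k _ => ?_
      rw [← Finset.sum_neg_distrib]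
      refine Finset.sum_congr rfl fun l _ => ?_
      rw [contr_comm, TensorProduct.tmul_neg, mul_left_comm]
    have h2 : (2 : ℂ) • dbar f (dbar f (r ⊗ₜ[ℂ] e)) = 0 := by
      rw [two_smul]; nth_rewrite 1 [h]; exact neg_add_cancel _
    exact (smul_eq_zero.1 h2).resolve_left two_ne_zero
  | add x y hx hy => rw [map_add, map_add, hx, hy, add_zero]

lemma homotopy (f : MvPolynomial (Fin N) ℂ) (b : Fin N → MvPolynomial (Fin N) ℂ) (y : PV N) :
    dbar f (hh b y) + hh b (dbar f y) = (∑ k, b k * pderiv k f) • y := by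
  induction y using TensorProduct.induction_on with
  | zero => simp
  | tmul r e =>
    rw [dbar_tmul, hh_tmul, map_sum, map_sum]
    simp only [dbar_tmul, hh_tmul]
    conv_lhs => enter [2]; rw [Finset.sum_comm]
    rw [← Finset.sum_add_distrib, Finset.sum_smul]
    refine Finset.sum_congr rfl fun k _ => ?_
    rw [← Finset.sum_add_distrib, Finset.sum_eq_single k]
    · rw [contr_ι_mul, mul_left_comm, ← TensorProduct.tmul_add, TensorProduct.smul_tmul']
      simp [mul_assoc]
    · intro l _ hl
      rw [contr_ι_mul, mul_left_comm, ← TensorProduct.tmul_add]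
      simp [hl]
    · simp
  | add x y hx hy => rw [map_add, map_add, map_add, map_add, smul_add, ← hx, ← hy]; abel

lemma tmul_mem {p : ℕ} (r : MvPolynomial (Fin N) ℂ) {e : ExtN N} (he : e ∈ grE N p) :
    r ⊗ₜ[ℂ] e ∈ PVgr N p := ⟨r ⊗ₜ ⟨e, he⟩, by simp⟩

lemma PVgr_induction {p : ℕ} {S : Submodule ℂ (PV N)} (T : PV N →ₗ[ℂ] PV N)
    (h : ∀ r, ∀ e ∈ grE N p, T (r ⊗ₜ[ℂ] e) ∈ S) {y : PV N} (hy : y ∈ PVgr N p) : T y ∈ S := by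
  obtain ⟨z, rfl⟩ := hy
  induction z using TensorProduct.induction_on with
  | zero => simp
  | tmul r e => simpa using h r e e.2
  | add x y hx hy => rw [map_add, map_add]; exact S.add_mem hx hy

lemma contr_mem (k : Fin N) (p : ℕ) : ∀ e ∈ grE N (p + 1), contr k e ∈ grE N p := by
  induction p with
  | zero =>
    intro e he
    rw [grE, zero_add, pow_one] at he
    obtain ⟨v, rfl⟩ := he
    have := contr_ι_mul k v 1
    rw [mul_one, contr_one, mul_zero, sub_zero] at this
    rw [this, grE, pow_zero]
    exact Submodule.smul_mem _ _ (Submodule.one_le.1 le_rfl)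
  | succ p ih =>
    intro e he
    rw [grE, pow_succ'] at he
    induction he using Submodule.mul_induction_on' with
    | mem_mul_mem m hm n hn =>
      obtain ⟨v, rfl⟩ := hm
      rw [contr_ι_mul]
      refine Submodule.sub_mem _ (Submodule.smul_mem _ _ hn) ?_
      rw [grE, pow_succ']
      exact Submodule.mul_mem_mul ⟨v, rfl⟩ (ih n hn)
    | add x _ y _ hx hy => rw [map_add]; exact Submodule.add_mem _ hx hy

lemma dbar_mem (f : MvPolynomial (Fin N) ℂ) {p : ℕ} {y : PV N} (hy : y ∈ PVgr N (p + 1)) :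
    dbar f y ∈ PVgr N p := by
  refine PVgr_induction _ (fun r e he => ?_) hy
  rw [dbar_tmul]
  exact Submodule.sum_mem _ fun k _ => tmul_mem _ (contr_mem k p e he)

lemma hh_mem (b : Fin N → MvPolynomial (Fin N) ℂ) {p : ℕ} {y : PV N} (hy : y ∈ PVgr N p) :
    hh b y ∈ PVgr N (p + 1) := by
  refine PVgr_induction _ (fun r e he => ?_) hy
  rw [hh_tmul]
  refine Submodule.sum_mem _ fun k _ => tmul_mem _ ?_
  rw [grE, pow_succ']
  exact Submodule.mul_mem_mul ⟨_, rfl⟩ he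

lemma PVgr_zero {p : ℕ} (hp : N < p) {y : PV N} (hy : y ∈ PVgr N p) : y = 0 := by
  have h0 : grE N p = ⊥ := by
    have : Module.finrank ℂ (⋀[ℂ]^p (Fin N → ℂ)) = 0 := by
      rw [exteriorPower.finrank_eq]; simpa using Nat.choose_eq_zero_of_lt hp
    change Module.finrank ℂ (grE N p) = 0 at this
    have hfin : Module.Finite ℂ (grE N p) := inferInstanceAs (Module.Finite ℂ (⋀[ℂ]^p (Fin N → ℂ)))
    exact Submodule.finrank_eq_zero.1 this
  have := PVgr_induction (S := ⊥) LinearMap.id (fun r e he => by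
    rw [h0] at he
    rw [(Submodule.mem_bot _).1 he]; simp) hy
  simpa using this

lemma exists_proj (p : ℕ) : ∃ π : ExtN N →ₗ[ℂ] ExtN N,
    (∀ e ∈ grE N p, π e = e) ∧ ∀ e, π e ∈ grE N p := by
  obtain ⟨g, hg⟩ := LinearMap.exists_leftInverse_of_injective (grE N p).subtype
    (Submodule.ker_subtype _)
  refine ⟨(grE N p).subtype ∘ₗ g, fun e he => ?_, fun e => (g e).2⟩
  have := LinearMap.congr_fun hg ⟨e, he⟩
  simp at this
  simp [this]

lemma IK_sup_gr {I : Ideal (MvPolynomial (Fin N) ℂ)} {a : MvPolynomial (Fin N) ℂ} {p : ℕ}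
    {y : PV N} (hy : y ∈ IK (Ideal.span {a} ⊔ I)) (hp : y ∈ PVgr N p) :
    ∃ c ∈ PVgr N p, ∃ i ∈ IK I, y = a • c + i := by
  obtain ⟨c, i, hi, h⟩ := IK_sup hy
  obtain ⟨π, h1, h2⟩ := exists_proj (N := N) p
  set Pj : PV N →ₗ[ℂ] PV N := TensorProduct.map (LinearMap.mulLeft ℂ 1) π with hPj
  have hPjy : Pj y = y := by
    have := PVgr_induction (S := ⊥) (Pj - LinearMap.id) (fun r e he => by
      simp [hPj, h1 e he]) hp
    simpa [sub_eq_zero] using this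
  refine ⟨Pj c, ?_, Pj i, map_mem_IK hi _ _, ?_⟩
  · clear h
    induction c using TensorProduct.induction_on with
    | zero => simp
    | tmul r e => simpa [hPj] using tmul_mem r (h2 e)
    | add x y hx hy => rw [map_add]; exact Submodule.add_mem _ hx hy
  · have hs : Pj (a • c) = a • Pj c := by
      clear h
      induction c using TensorProduct.induction_on with
      | zero => simp
      | tmul r e => simp [hPj, TensorProduct.smul_tmul']
      | add x y hx hy => rw [smul_add, map_add, map_add, hx, hy, smul_add]
    rw [← hs, ← map_add, ← h, hPjy]

/-- Exactness modulo `I` in degree `p`. -/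
def Ex (f : MvPolynomial (Fin N) ℂ) (I : Ideal (MvPolynomial (Fin N) ℂ)) (p : ℕ) : Prop :=
  ∀ z ∈ PVgr N p, dbar f z ∈ IK I → ∃ b ∈ PVgr N (p + 1), z - dbar f b ∈ IK I

lemma IK_mono {I I' : Ideal (MvPolynomial (Fin N) ℂ)} (h : I ≤ I') : IK I ≤ IK I' :=
  fun _ hy φ => h (hy φ)

lemma Ex_step {f : MvPolynomial (Fin N) ℂ} {I : Ideal (MvPolynomial (Fin N) ℂ)} {p : ℕ}
    {a : MvPolynomial (Fin N) ℂ} (ha : a ∈ jacobianIdeal f)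
    (hreg : ∀ r, a * r ∈ I → r ∈ I) (h : Ex f (Ideal.span {a} ⊔ I) (p + 1)) : Ex f I p := by
  intro z hz hdz
  obtain ⟨b, hb⟩ := (Ideal.mem_span_range_iff_exists_fun).1 ha
  have H := homotopy f b z
  rw [hb] at H
  have haz : a • z ∈ IK (Ideal.span {a} ⊔ I) := fun φ => by
    rw [cf_smul]
    exact Ideal.mul_mem_right _ _ (Ideal.mem_sup_left (Ideal.mem_span_singleton_self a))
  have h1 : dbar f (hh b z) ∈ IK (Ideal.span {a} ⊔ I) := by
    rw [eq_sub_of_add_eq H]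
    exact Submodule.sub_mem _ haz (IK_mono le_sup_right (hh_IK hdz b))
  obtain ⟨e, he, h2⟩ := h _ (hh_mem b hz) h1
  obtain ⟨c, hc, i, hi, h3⟩ := IK_sup_gr h2
    (Submodule.sub_mem _ (hh_mem b hz) (dbar_mem f he))
  refine ⟨c, hc, fun φ => hreg _ ?_⟩
  rw [← cf_smul]
  revert φ
  change a • (z - dbar f c) ∈ IK I
  have h4 := congrArg (dbar f) h3
  rw [map_sub, dbar_dbar, sub_zero, map_add, dbar_smul] at h4
  have : a • (z - dbar f c) = dbar f i + hh b (dbar f z) := by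
    rw [smul_sub, ← H, h4]; abel
  rw [this]
  exact Submodule.add_mem _ (dbar_IK hi f) (hh_IK hdz b)

/-- The ideal generated by `P_j(x_j)`, `j ∈ S`. -/
def IS (P : Fin N → Polynomial ℂ) (S : Finset (Fin N)) : Ideal (MvPolynomial (Fin N) ℂ) :=
  Ideal.span ((fun j => Polynomial.aeval (X j : MvPolynomial (Fin N) ℂ) (P j)) '' S)

lemma IS_reg (P : Fin N → Polynomial ℂ) (hP : ∀ j, (P j).Monic) (S : Finset (Fin N))
    (i : Fin N) (hi : i ∉ S) (r : MvPolynomial (Fin N) ℂ)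
    (hr : Polynomial.aeval (X i : MvPolynomial (Fin N) ℂ) (P i) * r ∈ IS P S) : r ∈ IS P S := by
  classical
  set Q := MvPolynomial (Fin N) ℂ ⧸ IS P S
  let mk : MvPolynomial (Fin N) ℂ →ₐ[ℂ] Q := Ideal.Quotient.mkₐ ℂ (IS P S)
  let σ : MvPolynomial (Fin N) ℂ →ₐ[ℂ] Polynomial Q :=
    MvPolynomial.aeval fun j => if j = i then Polynomial.X else Polynomial.C (mk (X j))
  let ε : Polynomial Q →ₐ[ℂ] Q := (Polynomial.aeval (mk (X i))).restrictScalars ℂ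
  have hεσ : ε.comp σ = mk := by
    refine MvPolynomial.algHom_ext fun j => ?_
    by_cases hj : j = i
    · subst hj; simp [ε, σ]
    · simp [ε, σ, hj]
  have hσI : ∀ s ∈ IS P S, σ s = 0 := by
    intro s hs
    have : IS P S ≤ RingHom.ker σ := by
      refine Ideal.span_le.2 ?_
      rintro _ ⟨j, hj, rfl⟩
      have hji : j ≠ i := fun h => hi (h ▸ hj)
      have h0 : mk (Polynomial.aeval (X j : MvPolynomial (Fin N) ℂ) (P j)) = 0 :=
        Ideal.Quotient.eq_zero_iff_mem.2 (Ideal.subset_span ⟨j, hj, rfl⟩)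
      change σ _ = 0
      rw [← Polynomial.aeval_algHom_apply] at h0 ⊢
      have : σ (X j) = (Algebra.ofId Q (Polynomial Q)).restrictScalars ℂ (mk (X j)) := by
        simp [σ, hji, Algebra.ofId_apply]
      rw [this, Polynomial.aeval_algHom_apply, h0, map_zero]
    exact this hs
  have h1 := hσI _ hr
  rw [map_mul, ← Polynomial.aeval_algHom_apply] at h1
  have h2 : Polynomial.aeval (σ (X i)) (P i) = (P i).map (algebraMap ℂ Q) := by
    have : σ (X i) = Polynomial.X := by simp [σ]
    rw [this, Polynomial.aeval_X_left_eq_map]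
  rw [h2] at h1
  have h3 : σ r = 0 := (((hP i).map (algebraMap ℂ Q)).mul_right_eq_zero_iff).1 h1
  have h4 : mk r = 0 := by rw [← hεσ, AlgHom.comp_apply, h3, map_zero]
  exact Ideal.Quotient.eq_zero_iff_mem.1 h4

lemma Ex_IS {f : MvPolynomial (Fin N) ℂ} (P : Fin N → Polynomial ℂ) (hP : ∀ j, (P j).Monic)
    (hJ : ∀ j, Polynomial.aeval (X j : MvPolynomial (Fin N) ℂ) (P j) ∈ jacobianIdeal f)
    (n : ℕ) : ∀ (S : Finset (Fin N)), S.card + n = N → ∀ p, S.card < p → Ex f (IS P S) p := by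
  classical
  induction n with
  | zero =>
    intro S hS p hp z hz _
    rw [PVgr_zero (by omega) hz]
    exact ⟨0, Submodule.zero_mem _, by simp⟩
  | succ n ih =>
    intro S hS p hp
    obtain ⟨i, hi⟩ : ∃ i, i ∉ S := by
      by_contra! h
      have : S = Finset.univ := Finset.eq_univ_iff_forall.2 h
      rw [this] at hS
      simp at hS
    refine Ex_step (hJ i) (IS_reg P hP S i hi) ?_
    have := ih (insert i S) (by rw [Finset.card_insert_of_notMem hi]; omega) (p + 1)
      (by rw [Finset.card_insert_of_notMem hi]; omega)
    rwa [IS, Finset.coe_insert, Set.image_insert_eq, Ideal.span_insert] at this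

lemma exists_P {f : MvPolynomial (Fin N) ℂ}
    (hiso : FiniteDimensional ℂ (MvPolynomial (Fin N) ℂ ⧸ jacobianIdeal f)) (j : Fin N) :
    ∃ P : Polynomial ℂ, P.Monic ∧
      Polynomial.aeval (X j : MvPolynomial (Fin N) ℂ) P ∈ jacobianIdeal f := by
  obtain ⟨P, hP, h⟩ := Algebra.IsIntegral.isIntegral (R := ℂ)
    (Ideal.Quotient.mkₐ ℂ (jacobianIdeal f) (X j))
  refine ⟨P, hP, Ideal.Quotient.eq_zero_iff_mem.1 ?_⟩
  change Ideal.Quotient.mkₐ ℂ (jacobianIdeal f) _ = 0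
  rw [← Polynomial.aeval_algHom_apply]
  exact h

end KZ

/-- If `f` defines a quasihomogeneous isolated singularity then the complex `(PV, ∂̄_f)` is
exact in positive exterior degrees, and in exterior degree zero the image of
`∂̄_f : PV^1 → PV^0 = R` is exactly the Jacobian ideal `J(f)`, so the degree zero cohomology
is `Jac(f)`. -/
theorem koszul_complex_exact (N : ℕ) (hN : 0 < N) (w : Fin N → ℤ) (hw : ∀ k, 0 < w k)
    (d : ℤ) (hd : 0 < d) (f : MvPolynomial (Fin N) ℂ) (hf : f.IsWeightedHomogeneous w d)
    (hiso : FiniteDimensional ℂ (MvPolynomial (Fin N) ℂ ⧸ jacobianIdeal f)) :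
    (∀ p : ℕ, 1 ≤ p → ∀ a ∈ PVgr N p,
      (dbar f a = 0 ↔ ∃ b ∈ PVgr N (p + 1), dbar f b = a)) ∧
    (∀ a : MvPolynomial (Fin N) ℂ,
      a ∈ jacobianIdeal f ↔ ∃ b ∈ PVgr N 1, dbar f b = a ⊗ₜ[ℂ] (1 : ExtN N)) := by
  refine ⟨fun p hp a ha => ⟨fun h => ?_, ?_⟩, fun a => ⟨fun ha => ?_, ?_⟩⟩
  · choose P hP hJ using KZ.exists_P hiso
    obtain ⟨b, hb, hab⟩ := KZ.Ex_IS P hP hJ N ∅ (by simp) p (by rw [Finset.card_empty]; omega) a ha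
      (by rw [h]; exact Submodule.zero_mem _)
    refine ⟨b, hb, ?_⟩
    have h0 : KZ.IS P ∅ = ⊥ := by simp [KZ.IS]
    rw [h0] at hab
    exact (sub_eq_zero.1 (KZ.IK_bot hab)).symm
  · rintro ⟨b, _, rfl⟩
    exact KZ.dbar_dbar f b
  · obtain ⟨b, hb⟩ := (Ideal.mem_span_range_iff_exists_fun).1 ha
    have H := KZ.homotopy f b (1 ⊗ₜ[ℂ] (1 : ExtN N))
    have h0 : dbar f (1 ⊗ₜ[ℂ] (1 : ExtN N)) = 0 := by
      simp [KZ.dbar_tmul, KZ.contr_one]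
    rw [hb, h0, map_zero, add_zero, TensorProduct.smul_tmul', smul_eq_mul, mul_one] at H
    refine ⟨_, KZ.hh_mem b (KZ.tmul_mem (p := 0) 1 ?_), H⟩
    rw [grE, pow_zero]
    exact (Submodule.one_le.1 le_rfl)
  · rintro ⟨b, _, hb⟩
    have h := congrArg (KZ.cf (ExteriorAlgebra.algebraMapInv.toLinearMap)) hb
    rw [KZ.cf_tmul] at h
    simp only [AlgHom.toLinearMap_apply, map_one, one_smul] at h
    rw [← h, dbar, LinearMap.sum_apply, map_sum]
    refine Submodule.sum_mem _ fun k _ => ?_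
    rw [KZ.cf_map]
    exact Ideal.mul_mem_right _ _ (Ideal.subset_span ⟨k, rfl⟩)
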